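/- arXiv:1107.5340 — 2 statements merged into one kernel-verified Lean document; each statement's English description precedes it below -/
import Mathlib

section
/- Let N be the 2m×m block column matrix N = [N_L; N_U]. Then for every j with 1 ≤ j ≤ m+1, the matrix B_j is invertible and B_j⁻¹ = T_{m−j+2} · N. -/
open Matrix

noncomputable section

/-- Lower triangular Toeplitz m×m matrix: entry (i,j) equals `a (i-j)` (0-based),
i.e. `a_{i-j+1}` in the 1-based notation of the paper, for j ≤ i, and 0 otherwise. -/
def lowT (m : ℕ) (a : Fin (m + 1) → ℝ) : Matrix (Fin m) (Fin m) ℝ :=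
  fun i j =>
    if h : (j : ℕ) ≤ (i : ℕ) then a ⟨(i : ℕ) - (j : ℕ), by have := i.2; omega⟩ else 0

/-- Upper triangular Toeplitz m×m matrix: entry (i,j) equals `a (m + i - j)` (0-based),
i.e. `a_{m+1+i-j}` in the 1-based notation of the paper, for i ≤ j, and 0 otherwise. -/
def upT (m : ℕ) (a : Fin (m + 1) → ℝ) : Matrix (Fin m) (Fin m) ℝ :=
  fun i j =>
    if h : (i : ℕ) ≤ (j : ℕ) then a ⟨m + (i : ℕ) - (j : ℕ), by have := j.2; omega⟩ else 0

/-- The 2m×2m Sylvester matrix S = [[D_L, N_L],[D_U, N_U]]. -/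
def sylv (m : ℕ) (d n : Fin (m + 1) → ℝ) : Matrix (Fin (m + m)) (Fin (m + m)) ℝ :=
  (fromBlocks (lowT m d) (lowT m n) (upT m d) (upT m n)).submatrix
    finSumFinEquiv.symm finSumFinEquiv.symm

/-- The 2m×2m lower triangular matrix D = [[D_L, 0],[D_U, D_L]]. -/
def dMat (m : ℕ) (d : Fin (m + 1) → ℝ) : Matrix (Fin (m + m)) (Fin (m + m)) ℝ :=
  (fromBlocks (lowT m d) (0 : Matrix (Fin m) (Fin m) ℝ) (upT m d) (lowT m d)).submatrix
    finSumFinEquiv.symm finSumFinEquiv.symm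

/-- The m×2m matrix formed by the last m rows of a 2m×2m matrix. -/
def lastRows (m : ℕ) (M : Matrix (Fin (m + m)) (Fin (m + m)) ℝ) :
    Matrix (Fin m) (Fin (m + m)) ℝ :=
  fun i j => M ⟨m + (i : ℕ), by have := i.2; omega⟩ j

/-- The m×m submatrix of an m×2m matrix consisting of the m consecutive columns
starting from column i (0-based; column i+1 in the 1-based notation of the paper). -/
def subCols (m : ℕ) (M : Matrix (Fin m) (Fin (m + m)) ℝ) (i : Fin (m + 1)) :
    Matrix (Fin m) (Fin m) ℝ :=
  fun r c => M r ⟨(i : ℕ) + (c : ℕ), by have := i.2; have := c.2; omega⟩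

/-- The kernel T = ( -D_U·D_L⁻¹ | I_m | -D_L·D_U⁻¹ ), an m×3m matrix. -/
def kerT (m : ℕ) (d : Fin (m + 1) → ℝ) : Matrix (Fin m) (Fin (m + m + m)) ℝ :=
  (fromCols
      (fromCols (-(upT m d * (lowT m d)⁻¹)) (1 : Matrix (Fin m) (Fin m) ℝ))
      (-(lowT m d * (upT m d)⁻¹))).submatrix id
    (((Equiv.sumCongr finSumFinEquiv (Equiv.refl (Fin m))).trans finSumFinEquiv).symm)

/-- T_i : the m×2m submatrix of T consisting of the 2m consecutive columns
starting from column i (0-based). -/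
def tSub (m : ℕ) (d : Fin (m + 1) → ℝ) (i : Fin (m + 1)) :
    Matrix (Fin m) (Fin (m + m)) ℝ :=
  fun r c => kerT m d r ⟨(i : ℕ) + (c : ℕ), by have := i.2; have := c.2; omega⟩

/-- T_{i,j} : the m×m submatrix of T_i consisting of the m consecutive columns
starting from column j (0-based). -/
def tSub2 (m : ℕ) (d : Fin (m + 1) → ℝ) (i j : Fin (m + 1)) :
    Matrix (Fin m) (Fin m) ℝ :=
  fun r c =>
    kerT m d r ⟨(i : ℕ) + (j : ℕ) + (c : ℕ), by have := i.2; have := j.2; have := c.2; omega⟩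

/-- The 2m×m block column matrix [D_L; D_U]. -/
def dlMat (m : ℕ) (d : Fin (m + 1) → ℝ) : Matrix (Fin (m + m)) (Fin m) ℝ :=
  (fromRows (lowT m d) (upT m d)).submatrix finSumFinEquiv.symm id

/-- The 2m×m block column matrix [0; D_L]. -/
def drMat (m : ℕ) (d : Fin (m + 1) → ℝ) : Matrix (Fin (m + m)) (Fin m) ℝ :=
  (fromRows (0 : Matrix (Fin m) (Fin m) ℝ) (lowT m d)).submatrix finSumFinEquiv.symm id

/-- The 2m×m block column matrix [N_L; N_U]. -/
def nMat (m : ℕ) (n : Fin (m + 1) → ℝ) : Matrix (Fin (m + m)) (Fin m) ℝ :=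
  (fromRows (lowT m n) (upT m n)).submatrix finSumFinEquiv.symm id

/-- The 3m×2m block matrix [[X_L, 0],[X_U, X_L],[0, X_U]] built from the
lower/upper triangular Toeplitz matrices of a. -/
def kMat (m : ℕ) (a : Fin (m + 1) → ℝ) : Matrix (Fin (m + m + m)) (Fin (m + m)) ℝ :=
  (fromRows
      (fromRows (fromCols (lowT m a) (0 : Matrix (Fin m) (Fin m) ℝ))
        (fromCols (upT m a) (lowT m a)))
      (fromCols (0 : Matrix (Fin m) (Fin m) ℝ) (upT m a))).submatrix
    (((Equiv.sumCongr finSumFinEquiv (Equiv.refl (Fin m))).trans finSumFinEquiv).symm)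
    finSumFinEquiv.symm

/-- Index reversal i ↦ m - i on 0-based indices, corresponding to the 1-based
index map i ↦ m - i + 2 of the paper. -/
def revIdx (m : ℕ) (i : Fin (m + 1)) : Fin (m + 1) := ⟨m - (i : ℕ), by omega⟩

theorem isUnit_lowT (m : ℕ) (d : Fin (m + 1) → ℝ) (hd : d 0 ≠ 0) : IsUnit (lowT m d) := by
  have htri : (lowT m d).BlockTriangular OrderDual.toDual := by
    intro i j hij
    have : (i : ℕ) < j := hij
    exact dif_neg (by omega)
  rw [Matrix.isUnit_iff_isUnit_det, Matrix.det_of_isLowerTriangular _ htri, isUnit_iff_ne_zero]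
  refine Finset.prod_ne_zero_iff.mpr fun i _ => ?_
  simpa [lowT] using hd

theorem isUnit_upT (m : ℕ) (d : Fin (m + 1) → ℝ) (hd : d (Fin.last m) ≠ 0) :
    IsUnit (upT m d) := by
  have htri : (upT m d).BlockTriangular id := by
    intro i j hij
    have : (j : ℕ) < i := hij
    exact dif_neg (by omega)
  rw [Matrix.isUnit_iff_isUnit_det, Matrix.det_of_isUpperTriangular htri, isUnit_iff_ne_zero]
  refine Finset.prod_ne_zero_iff.mpr fun i _ => ?_
  simpa [upT, Fin.last] using hd

theorem kerT_mul_kMat (m : ℕ) (d : Fin (m + 1) → ℝ) (h0 : d 0 ≠ 0) (hlast : d (Fin.last m) ≠ 0) :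
    kerT m d * kMat m d = 0 := by
  have hL := (Matrix.isUnit_iff_isUnit_det _).mp (isUnit_lowT m d h0)
  have hU := (Matrix.isUnit_iff_isUnit_det _).mp (isUnit_upT m d hlast)
  rw [kerT, kMat, Matrix.submatrix_mul_equiv, Matrix.fromCols_mul_fromRows,
    Matrix.fromCols_mul_fromRows, Matrix.mul_fromCols, Matrix.mul_fromCols, Matrix.mul_fromCols]
  simp only [Matrix.neg_mul, Matrix.mul_assoc, Matrix.nonsing_inv_mul _ hL,
    Matrix.nonsing_inv_mul _ hU, Matrix.mul_one, Matrix.one_mul, Matrix.mul_zero]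
  ext i j
  rcases h : finSumFinEquiv.symm j with k | k <;> simp [h]

/-- Entries of `kMat` form a banded Toeplitz matrix. -/
theorem kMat_apply (m : ℕ) (a : Fin (m + 1) → ℝ) (p : Fin (m + m + m)) (q : Fin (m + m)) :
    kMat m a p q =
      if h : (q : ℕ) ≤ p ∧ (p : ℕ) ≤ q + m then a ⟨(p : ℕ) - q, by omega⟩ else 0 := by
  cases p using Fin.addCases with
  | left p =>
    cases p using Fin.addCases <;> cases q using Fin.addCases <;>
      simp only [kMat, submatrix_apply, Equiv.symm_trans_apply, finSumFinEquiv_symm_apply_castAdd,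
        finSumFinEquiv_symm_apply_natAdd, Equiv.sumCongr_symm, Equiv.sumCongr_apply, Sum.map_inl,
        fromRows_apply_inl, fromRows_apply_inr, fromCols_apply_inl, fromCols_apply_inr,
        lowT, upT, Matrix.zero_apply, Fin.val_castAdd, Fin.val_natAdd] <;>
      grind
  | right p =>
    cases q using Fin.addCases <;>
      simp only [kMat, submatrix_apply, Equiv.symm_trans_apply, finSumFinEquiv_symm_apply_castAdd,
        finSumFinEquiv_symm_apply_natAdd, Equiv.sumCongr_symm, Equiv.sumCongr_apply, Sum.map_inr,
        Equiv.refl_symm, Equiv.refl_apply, fromRows_apply_inr, fromCols_apply_inl,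
        fromCols_apply_inr, upT, Matrix.zero_apply, Fin.val_castAdd, Fin.val_natAdd] <;>
      grind

/-- Entries of `dlMat` form a banded Toeplitz matrix. -/
theorem dlMat_apply (m : ℕ) (a : Fin (m + 1) → ℝ) (p : Fin (m + m)) (q : Fin m) :
    dlMat m a p q =
      if h : (q : ℕ) ≤ p ∧ (p : ℕ) ≤ q + m then a ⟨(p : ℕ) - q, by omega⟩ else 0 := by
  cases p using Fin.addCases <;>
    simp only [dlMat, submatrix_apply, finSumFinEquiv_symm_apply_castAdd,
      finSumFinEquiv_symm_apply_natAdd, fromRows_apply_inl, fromRows_apply_inr, id_eq,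
      lowT, upT, Fin.val_castAdd, Fin.val_natAdd] <;>
    grind

theorem tSub_mul_dlMat (m : ℕ) (d : Fin (m + 1) → ℝ) (h0 : d 0 ≠ 0)
    (hlast : d (Fin.last m) ≠ 0) (i : Fin (m + 1)) : tSub m d i * dlMat m d = 0 := by
  ext r q
  have hker := congrFun (congrFun (kerT_mul_kMat m d h0 hlast) r) ⟨i + q, by omega⟩
  rw [Matrix.zero_apply, Matrix.mul_apply] at hker ⊢
  rw [← hker]
  refine Fintype.sum_of_injective
    (fun c : Fin (m + m) => (⟨i + c, by omega⟩ : Fin (m + m + m))) ?_ _ _ ?_ ?_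
  · intro a b hab
    simpa [Fin.ext_iff] using hab
  · intro p hp
    rw [kMat_apply, dif_neg, mul_zero]
    rintro ⟨h₁, h₂⟩
    simp only at h₁ h₂
    exact hp ⟨⟨p - i, by omega⟩, Fin.ext (by simp only; omega)⟩
  · intro c
    simp only [tSub, kMat_apply, dlMat_apply]
    congr 1
    split_ifs with h₁ h₂ h₂
    · congr 2
      omega
    · omega
    · omega
    · rfl

theorem mul_sylv_castAdd (m : ℕ) (d n : Fin (m + 1) → ℝ) (M : Matrix (Fin m) (Fin (m + m)) ℝ)
    (r c : Fin m) : (M * sylv m d n) r (Fin.castAdd m c) = (M * dlMat m d) r c := by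
  simp [-Fin.natAdd_eq_addNat, Matrix.mul_apply, sylv, dlMat, Fin.sum_univ_add]

theorem mul_sylv_natAdd (m : ℕ) (d n : Fin (m + 1) → ℝ) (M : Matrix (Fin m) (Fin (m + m)) ℝ)
    (r c : Fin m) : (M * sylv m d n) r (Fin.natAdd m c) = (M * nMat m n) r c := by
  simp [-Fin.natAdd_eq_addNat, Matrix.mul_apply, sylv, nMat, Fin.sum_univ_add]

theorem tSub_eq_mul_lastRows (m : ℕ) (d n : Fin (m + 1) → ℝ) (h0 : d 0 ≠ 0)
    (hlast : d (Fin.last m) ≠ 0) (hS : IsUnit (sylv m d n)) (i : Fin (m + 1)) :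
    tSub m d i = tSub m d i * nMat m n * lastRows m (sylv m d n)⁻¹ := by
  have hdet := (Matrix.isUnit_iff_isUnit_det _).mp hS
  ext r c
  conv_lhs => rw [← Matrix.mul_nonsing_inv_cancel_right _ (tSub m d i) hdet]
  rw [Matrix.mul_apply, Fin.sum_univ_add, Matrix.mul_apply]
  simp only [mul_sylv_castAdd, mul_sylv_natAdd, tSub_mul_dlMat m d h0 hlast,
    Matrix.zero_apply, zero_mul, Finset.sum_const_zero, zero_add]
  rfl

/-- The window of `m` columns of `T` starting at column `m` is the identity block. -/
theorem subCols_tSub_revIdx (m : ℕ) (d : Fin (m + 1) → ℝ) (j : Fin (m + 1)) :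
    subCols m (tSub m d (revIdx m j)) j = 1 := by
  ext r c
  have hidx : (⟨(revIdx m j : ℕ) + ((j : ℕ) + c), by simp only [revIdx]; omega⟩ :
      Fin (m + m + m)) = Fin.castAdd m (Fin.natAdd m c) := by
    ext
    simp [revIdx]
    omega
  simp only [subCols, tSub, hidx]
  simp [-Fin.natAdd_eq_addNat, kerT]

theorem bSub_inv_eq (m : ℕ) (hm : 1 ≤ m) (d n : Fin (m + 1) → ℝ) (hd : ∀ k, d k ≠ 0) (hn : ∀ k, n k ≠ 0)
    (hS : IsUnit (sylv m d n)) :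
    ∀ j : Fin (m + 1),
      IsUnit (subCols m (lastRows m (sylv m d n)⁻¹) j) ∧
        (subCols m (lastRows m (sylv m d n)⁻¹) j)⁻¹ = tSub m d (revIdx m j) * nMat m n := by
  intro j
  have hmul : tSub m d (revIdx m j) * nMat m n * subCols m (lastRows m (sylv m d n)⁻¹) j = 1 := by
    rw [← subCols_tSub_revIdx m d j]
    conv_rhs => rw [tSub_eq_mul_lastRows m d n (hd _) (hd _) hS]
    rfl
  exact ⟨IsUnit.of_mul_eq_one_right _ hmul, Matrix.inv_eq_left_inv hmul⟩
end
end

section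
/- For all i, j with 1 ≤ i, j ≤ m+1, the matrix A_i is invertible and A_i⁻¹ · A_j = T_{m−i+2, j}. -/
open Matrix

noncomputable section

/-- Extension by zero of a finite sequence to all natural indices. -/
def extendZero {N : ℕ} (f : Fin N → ℝ) (p : ℕ) : ℝ := if h : p < N then f ⟨p, h⟩ else 0

lemma extendZero_of_lt {N : ℕ} (f : Fin N → ℝ) {p : ℕ} (h : p < N) :
    extendZero f p = f ⟨p, h⟩ := dif_pos h

lemma lowT_apply (m : ℕ) (d : Fin (m + 1) → ℝ) (a c : Fin m) :
    lowT m d a c = if (c : ℕ) ≤ a then extendZero d (a - c) else 0 := by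
  unfold lowT extendZero
  split_ifs with h h' <;> first | rfl | omega

lemma upT_apply (m : ℕ) (d : Fin (m + 1) → ℝ) (a c : Fin m) :
    upT m d a c = if (c : ℕ) ≤ m + a then extendZero d (m + a - c) else 0 := by
  unfold upT extendZero
  split_ifs <;> first | rfl | omega

/-- A linear recurrence with nonzero extreme coefficients, valid for the first `m` windows, forces
a sequence vanishing on `m` consecutive indices to vanish on the first `2 * m` indices. -/
lemma eq_zero_of_recurrence {m i : ℕ} {e d : ℕ → ℝ} (h0 : d 0 ≠ 0) (hm : d m ≠ 0) (hi : i ≤ m)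
    (hrec : ∀ q < m, ∑ k ∈ Finset.range (m + 1), e (q + k) * d k = 0)
    (hwin : ∀ k < m, e (i + k) = 0) : ∀ q < m + m, e q = 0 := by
  have up : ∀ q, i ≤ q → q < m + m → e q = 0 := by
    intro q
    induction q using Nat.strong_induction_on with
    | _ q ih =>
      intro hq hq2
      by_cases hlt : q < i + m
      · have := hwin (q - i) (by omega)
        rwa [Nat.add_sub_cancel' hq] at this
      · have hr := hrec (q - m) (by omega)
        rw [Finset.sum_range_succ, Finset.sum_eq_zero, zero_add,
          Nat.sub_add_cancel (by omega)] at hr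
        · exact (mul_eq_zero.mp hr).resolve_right hm
        · intro k hk
          have := Finset.mem_range.mp hk
          rw [ih (q - m + k) (by omega) (by omega) (by omega), zero_mul]
  have down : ∀ s, 0 < s → ∀ q, q + s = i → e q = 0 := by
    intro s
    induction s using Nat.strong_induction_on with
    | _ s ih =>
      intro hs q hq
      have hr := hrec q (by omega)
      rw [Finset.sum_range_succ', Finset.sum_eq_zero, zero_add, add_zero] at hr
      · exact (mul_eq_zero.mp hr).resolve_right h0
      · intro k hk
        have := Finset.mem_range.mp hk
        have hz : e (q + (k + 1)) = 0 := by
          by_cases hle : i ≤ q + (k + 1)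
          · exact up _ hle (by omega)
          · exact ih (i - (q + (k + 1))) (by omega) (by omega) _ (by omega)
        rw [hz, zero_mul]
  intro q hq
  by_cases h : i ≤ q
  · exact up q h hq
  · exact down (i - q) (by omega) q (by omega)

/-- Multiplying a row by a column of the stacked matrix `[D_L; D_U]` is a convolution. -/
lemma sum_lowT_add_sum_upT (m : ℕ) (d : Fin (m + 1) → ℝ) (z : ℕ → ℝ) (c : Fin m) :
    ∑ a : Fin m, z a * lowT m d a c + ∑ a : Fin m, z (m + a) * upT m d a c =
      ∑ k ∈ Finset.range (m + 1), z (c + k) * extendZero d k := by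
  have hc := c.2
  let g : ℕ → ℝ := fun p => z p * if (c : ℕ) ≤ p then extendZero d (p - c) else 0
  have hlow : ∑ a : Fin m, z a * lowT m d a c = ∑ p ∈ Finset.range m, g p := by
    simp only [lowT_apply, g]
    exact Fin.sum_univ_eq_sum_range g m
  have hup : ∑ a : Fin m, z (m + a) * upT m d a c = ∑ p ∈ Finset.range m, g (m + p) := by
    simp only [upT_apply, g]
    exact Fin.sum_univ_eq_sum_range (fun p => g (m + p)) m
  rw [hlow, hup, ← Finset.sum_range_add,
    show m + m = (c + (m + 1)) + (m - 1 - c) by omega, Finset.sum_range_add,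
    Finset.sum_range_add, Finset.sum_eq_zero, zero_add, add_eq_left.mpr]
  · refine Finset.sum_congr rfl fun k _ => ?_
    simp [g]
  · refine Finset.sum_eq_zero fun k _ => ?_
    simp only [g, extendZero]
    rw [if_pos (by omega), dif_neg (by omega), mul_zero]
  · intro p hp
    have := Finset.mem_range.mp hp
    simp only [g]
    rw [if_neg (by omega), mul_zero]

lemma isUnit_det_lowT (m : ℕ) (d : Fin (m + 1) → ℝ) (h : d 0 ≠ 0) : IsUnit (lowT m d).det := by
  rw [det_of_isLowerTriangular, isUnit_iff_ne_zero, Finset.prod_ne_zero_iff]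
  · intro a _
    simpa [lowT] using h
  · intro a b hab
    exact dif_neg (not_le.mpr (show (a : ℕ) < b from hab))

lemma isUnit_det_upT (m : ℕ) (d : Fin (m + 1) → ℝ) (h : d (Fin.last m) ≠ 0) :
    IsUnit (upT m d).det := by
  rw [det_of_isUpperTriangular, isUnit_iff_ne_zero, Finset.prod_ne_zero_iff]
  · intro a _
    simpa [upT, Fin.last] using h
  · intro a b hab
    exact dif_neg (not_le.mpr (show (b : ℕ) < a from hab))

lemma kerT_left (m : ℕ) (d : Fin (m + 1) → ℝ) (r a : Fin m) :
    extendZero (kerT m d r) a = (-(upT m d * (lowT m d)⁻¹)) r a := by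
  rw [extendZero_of_lt _ (by omega),
    show (⟨(a : ℕ), by omega⟩ : Fin (m + m + m)) = Fin.castAdd m (Fin.castAdd m a) from rfl]
  simp [kerT]

lemma kerT_middle (m : ℕ) (d : Fin (m + 1) → ℝ) (r a : Fin m) :
    extendZero (kerT m d r) (m + a) = (1 : Matrix (Fin m) (Fin m) ℝ) r a := by
  rw [extendZero_of_lt _ (by omega),
    show (⟨m + (a : ℕ), by omega⟩ : Fin (m + m + m)) = Fin.castAdd m (Fin.natAdd m a) from rfl]
  simp [kerT, -Fin.natAdd_eq_addNat]

lemma kerT_right (m : ℕ) (d : Fin (m + 1) → ℝ) (r a : Fin m) :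
    extendZero (kerT m d r) (m + (m + a)) = (-(lowT m d * (upT m d)⁻¹)) r a := by
  rw [extendZero_of_lt _ (by omega),
    show (⟨m + (m + (a : ℕ)), by omega⟩ : Fin (m + m + m)) = Fin.natAdd (m + m) a from
      Fin.ext (add_assoc _ _ _).symm]
  simp [kerT]

/-- Every row of `kerT` satisfies the recurrence with coefficients `d`. -/
lemma kerT_recurrence (m : ℕ) (d : Fin (m + 1) → ℝ) (h0 : d 0 ≠ 0) (hm : d (Fin.last m) ≠ 0)
    (r : Fin m) {q : ℕ} (hq : q < m + m) :
    ∑ k ∈ Finset.range (m + 1), extendZero (kerT m d r) (q + k) * extendZero d k = 0 := by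
  by_cases hqm : q < m
  · have := sum_lowT_add_sum_upT m d (extendZero (kerT m d r)) ⟨q, hqm⟩
    rw [← this]
    simp only [kerT_left, kerT_middle, ← mul_apply, ← Matrix.add_apply]
    rw [neg_mul, nonsing_inv_mul_cancel_right _ _ (isUnit_det_lowT m d h0), one_mul,
      neg_add_cancel, Matrix.zero_apply]
  · have := sum_lowT_add_sum_upT m d (fun p => extendZero (kerT m d r) (m + p))
      ⟨q - m, by omega⟩
    simp only [← add_assoc, Nat.add_sub_cancel' (not_lt.mp hqm)] at this
    rw [← this]
    simp only [add_assoc, kerT_right, kerT_middle, ← mul_apply, ← Matrix.add_apply]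
    rw [neg_mul, nonsing_inv_mul_cancel_right _ _ (isUnit_det_upT m d hm), one_mul,
      add_neg_cancel, Matrix.zero_apply]

/-- The row-column products of the last rows of `D⁻¹` with `D`, split into blocks. -/
lemma lastRows_inv_mul (m : ℕ) (d : Fin (m + 1) → ℝ) (hD : IsUnit (dMat m d)) (r : Fin m)
    (c : Fin m ⊕ Fin m) :
    ∑ a : Fin m, extendZero (lastRows m (dMat m d)⁻¹ r) a *
        fromCols (lowT m d) (0 : Matrix (Fin m) (Fin m) ℝ) a c +
      ∑ a : Fin m, extendZero (lastRows m (dMat m d)⁻¹ r) (m + a) *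
        fromCols (upT m d) (lowT m d) a c =
      (1 : Matrix (Fin m ⊕ Fin m) (Fin m ⊕ Fin m) ℝ) (Sum.inr r) c := by
  have h := congrFun₂ (nonsing_inv_mul (dMat m d) ((isUnit_iff_isUnit_det _).mp hD))
    (Fin.natAdd m r) (finSumFinEquiv c)
  rw [mul_apply, Fin.sum_univ_add] at h
  have h1 : (1 : Matrix (Fin (m + m)) (Fin (m + m)) ℝ) (Fin.natAdd m r) (finSumFinEquiv c) =
      (1 : Matrix (Fin m ⊕ Fin m) (Fin m ⊕ Fin m) ℝ) (Sum.inr r) c := by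
    rw [← finSumFinEquiv_apply_right, one_apply, one_apply]
    simp only [finSumFinEquiv.injective.eq_iff]
  rw [← h1, ← h]
  congr 1
  all_goals
    refine Finset.sum_congr rfl fun a _ => ?_
    rw [extendZero_of_lt _ (by omega)]
    congr 1
    cases c <;> simp [dMat, -Fin.natAdd_eq_addNat]

lemma lastRows_recurrence (m : ℕ) (d : Fin (m + 1) → ℝ) (hD : IsUnit (dMat m d)) (r : Fin m)
    {q : ℕ} (hq : q < m) :
    ∑ k ∈ Finset.range (m + 1),
      extendZero (lastRows m (dMat m d)⁻¹ r) (q + k) * extendZero d k = 0 := by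
  have h := lastRows_inv_mul m d hD r (Sum.inl ⟨q, hq⟩)
  simp only [fromCols_apply_inl] at h
  rw [sum_lowT_add_sum_upT] at h
  simpa using h

lemma subCols_apply (m : ℕ) (M : Matrix (Fin m) (Fin (m + m)) ℝ) (i : Fin (m + 1))
    (r c : Fin m) : subCols m M i r c = extendZero (M r) (i + c) :=
  (extendZero_of_lt (M r) (by omega)).symm

lemma isUnit_subCols_last (m : ℕ) (d : Fin (m + 1) → ℝ) (hD : IsUnit (dMat m d)) :
    IsUnit (subCols m (lastRows m (dMat m d)⁻¹) (Fin.last m)) := by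
  refine IsUnit.of_mul_eq_one (lowT m d) ?_
  ext r c
  have h := lastRows_inv_mul m d hD r (Sum.inr c)
  simp only [fromCols_apply_inr, Matrix.zero_apply, mul_zero, Finset.sum_const_zero, zero_add] at h
  simpa [mul_apply, subCols_apply, one_apply] using h

lemma subCols_mul_tSub2 (m : ℕ) (d : Fin (m + 1) → ℝ) (h0 : d 0 ≠ 0)
    (hm : d (Fin.last m) ≠ 0) (hD : IsUnit (dMat m d)) (i j : Fin (m + 1)) :
    subCols m (lastRows m (dMat m d)⁻¹) i * tSub2 m d (revIdx m i) j =
      subCols m (lastRows m (dMat m d)⁻¹) j := by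
  set B := lastRows m (dMat m d)⁻¹ with hB
  have hi := i.2
  ext r c
  let u : ℕ → ℝ := fun q => ∑ l : Fin m, subCols m B i r l *
    extendZero (kerT m d l) (m - i + q)
  have key := eq_zero_of_recurrence (m := m) (i := i) (e := fun q => u q - extendZero (B r) q)
    (d := extendZero d) (by simpa [extendZero] using h0)
    (by simpa [extendZero, Fin.last] using hm) (by omega) ?_ ?_ (j + c) (by omega)
  · rw [subCols_apply m B j, ← sub_eq_zero, ← key, mul_apply]
    congr 1
    refine Finset.sum_congr rfl fun l _ => ?_
    rw [← add_assoc, extendZero_of_lt _ (by omega)]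
    rfl
  · intro q hq
    simp only [sub_mul, Finset.sum_sub_distrib]
    rw [hB, lastRows_recurrence m d hD r hq, sub_zero]
    simp only [u, Finset.sum_mul]
    rw [Finset.sum_comm]
    refine Finset.sum_eq_zero fun l _ => ?_
    simp only [mul_assoc, ← Finset.mul_sum, ← add_assoc]
    rw [kerT_recurrence m d h0 hm l (by omega), mul_zero]
  · intro k hk
    have hidx : m - (i : ℕ) + (i + k) = m + k := by omega
    simp only [u, hidx]
    have hT : ∀ l : Fin m, extendZero (kerT m d l) (m + k) =
        (1 : Matrix (Fin m) (Fin m) ℝ) l ⟨k, hk⟩ := fun l => kerT_middle m d l ⟨k, hk⟩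
    simp only [hT]
    rw [← mul_apply, mul_one, subCols_apply, sub_self]

theorem inv_aSub_mul_aSub (m : ℕ) (hm : 1 ≤ m) (d n : Fin (m + 1) → ℝ) (hd : ∀ k, d k ≠ 0) (hn : ∀ k, n k ≠ 0)
    (hD : IsUnit (dMat m d)) :
    ∀ i j : Fin (m + 1),
      IsUnit (subCols m (lastRows m (dMat m d)⁻¹) i) ∧
        (subCols m (lastRows m (dMat m d)⁻¹) i)⁻¹ * subCols m (lastRows m (dMat m d)⁻¹) j = tSub2 m d (revIdx m i) j := by
  intro i j
  have hmul := subCols_mul_tSub2 m d (hd 0) (hd _) hD i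
  have hunit : IsUnit (subCols m (lastRows m (dMat m d)⁻¹) i) := by
    have h := isUnit_subCols_last m d hD
    rw [← hmul (Fin.last m), isUnit_iff_isUnit_det, det_mul] at h
    exact (isUnit_iff_isUnit_det _).mpr (isUnit_of_mul_isUnit_left h)
  refine ⟨hunit, ?_⟩
  rw [← hmul j, nonsing_inv_mul_cancel_left _ _ ((isUnit_iff_isUnit_det _).mp hunit)]
end
end
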